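/- Let D ⊂ ℝ^d be an open bounded set and let f : cl(D) → ℝ be twice continuously differentiable on the compact closure cl(D). Suppose f attains its maximum over cl(D) at a unique point x₀ which lies in the open set D, and the Hessian matrix Hess f(x₀) is negative definite. Then, as λ → +∞ (real λ), ∫_D |det Hess f(x)|^{1/2} e^{λ f(x)} dx ~ (2π/λ)^{d/2} e^{λ f(x₀)}, i.e. the ratio of the two sides tends to 1. -/

import Mathlib

open MeasureTheory Filter Real

/-- The Hessian matrix of second partial derivatives of `f : ℝ^d → ℝ` at `x`. -/
noncomputable def Hess {d : ℕ} (f : (Fin d → ℝ) → ℝ) (x : Fin d → ℝ) :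
    Matrix (Fin d) (Fin d) ℝ :=
  Matrix.of fun i j =>
    fderiv ℝ (fun y => fderiv ℝ f y (Pi.single j 1)) x (Pi.single i 1)


theorem lap_taylor {E : Type*} [NormedAddCommGroup E] [NormedSpace ℝ E] {f : E → ℝ} {x₀ : E}
    (hf : ContDiffAt ℝ 2 f x₀) (h0 : fderiv ℝ f x₀ = 0) {ε : ℝ} (hε : 0 < ε) :
    ∃ δ > 0, ∀ h : E, ‖h‖ < δ →
      |f (x₀ + h) - f x₀ - 1 / 2 * fderiv ℝ (fderiv ℝ f) x₀ h h| ≤ ε * ‖h‖ ^ 2 := by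
  set B := fderiv ℝ (fderiv ℝ f) x₀ with hB
  have hsymm : IsSymmSndFDerivAt ℝ f x₀ := hf.isSymmSndFDerivAt (by simp)
  have hd : HasFDerivAt (fderiv ℝ f) B x₀ :=
    ((hf.fderiv_right (m := 1) (by norm_num)).differentiableAt (by norm_num)).hasFDerivAt
  have h1 := (hasFDerivAt_iff_isLittleO_nhds_zero.1 hd).def hε
  have h2 : ∀ᶠ h in nhds (0 : E), DifferentiableAt ℝ f (x₀ + h) := by
    have : ∀ᶠ x in nhds x₀, ContDiffAt ℝ 2 f x := hf.eventually (by simp)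
    have ht : Tendsto (fun h : E => x₀ + h) (nhds 0) (nhds x₀) := by
      have : Continuous (fun h : E => x₀ + h) := by fun_prop
      simpa using this.tendsto 0
    filter_upwards [ht.eventually this] with h hh using hh.differentiableAt (by norm_num)
  obtain ⟨δ, hδ, hb⟩ := Metric.eventually_nhds_iff_ball.1 (h1.and h2)
  refine ⟨δ, hδ, fun h hh => ?_⟩
  have key := (convex_closedBall (0:E) ‖h‖).norm_image_sub_le_of_norm_hasFDerivWithin_le
    (f := fun k => f (x₀ + k) - 1 / 2 * B k k)
    (f' := fun k => fderiv ℝ f (x₀ + k) - B k) (C := ε * ‖h‖) (x := 0) (y := h)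
    (fun k hk => ?_) (fun k hk => ?_) (by simp) (by simp)
  · simp only [add_zero, map_zero, mul_zero, sub_zero] at key
    rw [Real.norm_eq_abs] at key
    calc _ = |f (x₀ + h) - 1 / 2 * B h h - f x₀| := by congr 1; ring
      _ ≤ _ := key
      _ = _ := by ring
  · have hk' : k ∈ Metric.ball (0:E) δ := by
      simp only [Metric.mem_closedBall, dist_zero_right, Metric.mem_ball] at hk ⊢
      linarith
    have d1 : HasFDerivAt (fun k => f (x₀ + k)) (fderiv ℝ f (x₀ + k)) k :=
      (hasFDerivAt_comp_add_left x₀).2 ((hb k hk').2.hasFDerivAt)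
    have d2 : HasFDerivAt (fun k => B k k) (B k + B.flip k) k := by
      have := (B.hasFDerivAt (x := k)).clm_apply (hasFDerivAt_id k)
      exact this.congr_fderiv (by ext; simp)
    have d3 := d1.sub (d2.const_mul (1 / 2))
    refine (d3.congr_fderiv ?_).hasFDerivWithinAt
    ext v
    have := hsymm v k
    simp only [← hB] at this
    simp [this]
    ring
  · have hk' : k ∈ Metric.ball (0:E) δ := by
      simp only [Metric.mem_closedBall, dist_zero_right, Metric.mem_ball] at hk ⊢
      linarith
    have := (hb k hk').1
    rw [h0, sub_zero] at this
    refine this.trans ?_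
    simp only [Metric.mem_closedBall, dist_zero_right] at hk
    gcongr

theorem lap_gauss {d : ℕ} (A : Matrix (Fin d) (Fin d) ℝ) (hA : A.PosDef) :
    ∫ y : Fin d → ℝ, Real.exp (-(1 / 2) * (y ⬝ᵥ A.mulVec y)) =
      (2 * π) ^ ((d : ℝ) / 2) / Real.sqrt A.det := by
  open scoped MatrixOrder in
  obtain ⟨B, rfl⟩ := CStarAlgebra.nonneg_iff_eq_star_mul_self.mp hA.posSemidef.nonneg
  have hdet : (star B * B).det = B.det ^ 2 := by
    rw [Matrix.star_eq_conjTranspose, Matrix.conjTranspose_eq_transpose_of_trivial,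
      Matrix.det_mul, Matrix.det_transpose, sq]
  have hB : B.det ≠ 0 := by
    intro h
    have := hA.det_pos
    rw [hdet, h] at this
    simp at this
  have hq : ∀ y : Fin d → ℝ, y ⬝ᵥ (star B * B).mulVec y = ∑ i, (B.mulVec y i) ^ 2 := by
    intro y
    rw [Matrix.star_eq_conjTranspose, Matrix.conjTranspose_eq_transpose_of_trivial,
      ← Matrix.mulVec_mulVec, Matrix.dotProduct_mulVec, Matrix.vecMul_transpose]
    simp [dotProduct, sq]
  simp_rw [hq]
  have hmap := Real.map_matrix_volume_pi_eq_smul_volume_pi hB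
  have hint : ∫ z : Fin d → ℝ, Real.exp (-(1 / 2) * ∑ i, z i ^ 2) = (2 * π) ^ ((d : ℝ) / 2) := by
    have : ∀ z : Fin d → ℝ, Real.exp (-(1 / 2) * ∑ i, z i ^ 2)
        = ∏ i, Real.exp (-(1 / 2) * z i ^ 2) := by
      intro z; rw [Finset.mul_sum, Real.exp_sum]
    simp_rw [this]
    rw [integral_fintype_prod_volume_eq_prod (fun (_ : Fin d) (t : ℝ) => Real.exp (-(1 / 2) * t ^ 2))]
    simp only [integral_gaussian, Finset.prod_const, Finset.card_univ, Fintype.card_fin]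
    rw [show π / (1 / 2) = 2 * π by ring, Real.sqrt_eq_rpow, ← Real.rpow_mul_natCast (by positivity)]
    congr 1; ring
  have hm : AEMeasurable (Matrix.toLin' B) (volume : Measure (Fin d → ℝ)) :=
    (LinearMap.continuous_of_finiteDimensional _).measurable.aemeasurable
  have hcv := integral_map (μ := volume) hm
    (f := fun z : Fin d → ℝ => Real.exp (-(1 / 2) * ∑ i, z i ^ 2))
    (by apply Continuous.aestronglyMeasurable; fun_prop)
  rw [hmap, integral_smul_measure, hint] at hcv
  simp only [Matrix.toLin'_apply] at hcv
  rw [← hcv, hdet, Real.sqrt_sq_eq_abs, ENNReal.toReal_ofReal (abs_nonneg _), abs_inv, smul_eq_mul]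
  field_simp

theorem lap_coercive {d : ℕ} (A : Matrix (Fin d) (Fin d) ℝ) (hA : A.PosDef) :
    ∃ c > 0, ∀ y : Fin d → ℝ, c * ‖y‖ ^ 2 ≤ y ⬝ᵥ A.mulVec y := by
  have hpos : ∀ y : Fin d → ℝ, y ≠ 0 → 0 < y ⬝ᵥ A.mulVec y := by
    intro y hy
    simpa using (Matrix.posDef_iff_dotProduct_mulVec.1 hA).2 hy
  have hcont : Continuous fun y : Fin d → ℝ => y ⬝ᵥ A.mulVec y := by
    simp only [dotProduct, Matrix.mulVec]; fun_prop
  rcases (Metric.sphere (0 : Fin d → ℝ) 1).eq_empty_or_nonempty with he | hne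
  · refine ⟨1, one_pos, fun y => ?_⟩
    have : y = 0 := by
      by_contra hy
      have : ‖y‖⁻¹ • y ∈ Metric.sphere (0 : Fin d → ℝ) 1 := by
        simp [norm_smul, hy]
      rw [he] at this; exact this
    simp [this]
  · obtain ⟨u, hu, hmin⟩ := (isCompact_sphere (0 : Fin d → ℝ) 1).exists_isMinOn hne hcont.continuousOn
    refine ⟨_, hpos u ?_, fun y => ?_⟩
    · rintro rfl; simp at hu
    · by_cases hy : y = 0
      · simp [hy]
      have hm : ‖y‖⁻¹ • y ∈ Metric.sphere (0 : Fin d → ℝ) 1 := by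
        simp [norm_smul, hy]
      have := hmin hm
      simp only [Set.mem_ofPred_eq, Matrix.mulVec_smul, dotProduct_smul, smul_dotProduct, smul_eq_mul] at this
      have hn : 0 < ‖y‖ := norm_pos_iff.2 hy
      calc _ ≤ (‖y‖⁻¹ * (‖y‖⁻¹ * (y ⬝ᵥ A.mulVec y))) * ‖y‖ ^ 2 := by gcongr
        _ = _ := by field_simp

theorem lap_hess_apply {d : ℕ} {f : (Fin d → ℝ) → ℝ} {x : Fin d → ℝ}
    (hf : ContDiffAt ℝ 2 f x) (i j : Fin d) :
    Hess f x i j = fderiv ℝ (fderiv ℝ f) x (Pi.single i 1) (Pi.single j 1) := by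
  have hd : DifferentiableAt ℝ (fderiv ℝ f) x :=
    (hf.fderiv_right (m := 1) (by norm_num)).differentiableAt (by norm_num)
  have := hd.hasFDerivAt.clm_apply (hasFDerivAt_const (Pi.single j (1:ℝ) : Fin d → ℝ) x)
  simp only [Hess, Matrix.of_apply]
  rw [this.fderiv]
  simp

theorem lap_hess_quad {d : ℕ} {f : (Fin d → ℝ) → ℝ} {x : Fin d → ℝ}
    (hf : ContDiffAt ℝ 2 f x) (h : Fin d → ℝ) :
    fderiv ℝ (fderiv ℝ f) x h h = - (h ⬝ᵥ (-(Hess f x)).mulVec h) := by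
  have hh : h = ∑ i, h i • (Pi.single i (1:ℝ) : Fin d → ℝ) := by
    ext k; simp [Finset.sum_apply, Pi.single_apply]
  have e1 : fderiv ℝ (fderiv ℝ f) x h h = ∑ i, h i * ∑ j, h j * Hess f x i j := by
    conv_lhs => rw [hh]
    simp only [map_sum, map_smul, _root_.sum_apply, _root_.smul_apply,
      smul_eq_mul, lap_hess_apply hf, Finset.mul_sum]
    rw [Finset.sum_comm]
    refine Finset.sum_congr rfl fun i _ => Finset.sum_congr rfl fun j _ => ?_
    ring
  rw [e1, Matrix.neg_mulVec, dotProduct_neg, neg_neg]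
  simp only [dotProduct, Matrix.mulVec]
  refine Finset.sum_congr rfl fun i _ => ?_
  congr 1
  exact Finset.sum_congr rfl fun j _ => mul_comm _ _

theorem lap_hess_bound {d : ℕ} (D : Set (Fin d → ℝ)) (f : (Fin d → ℝ) → ℝ)
    (hD_open : IsOpen D) (hD_bdd : Bornology.IsBounded D)
    (hf : ContDiffOn ℝ 2 f (closure D)) :
    ∃ C : ℝ, ∀ x ∈ D, ∀ i j, |Hess f x i j| ≤ C := by
  have hK : IsCompact (closure D) := hD_bdd.isCompact_closure
  have hcd : ∀ x ∈ D, ContDiffAt ℝ 2 f x := fun x hx =>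
    hf.contDiffAt (mem_of_superset (hD_open.mem_nhds hx) subset_closure)
  have : ∃ C : ℝ, ∀ x ∈ closure D ∩ D, ‖iteratedFDeriv ℝ 2 f x‖ ≤ C := by
    refine hK.induction_on (p := fun s => ∃ C : ℝ, ∀ x ∈ s ∩ D, ‖iteratedFDeriv ℝ 2 f x‖ ≤ C)
      ⟨0, by simp⟩ ?_ ?_ ?_
    · rintro s t hst ⟨C, hC⟩
      exact ⟨C, fun x hx => hC x ⟨hst hx.1, hx.2⟩⟩
    · rintro s t ⟨C, hC⟩ ⟨C', hC'⟩
      refine ⟨max C C', ?_⟩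
      rintro x ⟨hx | hx, hxD⟩
      · exact (hC x ⟨hx, hxD⟩).trans (le_max_left _ _)
      · exact (hC' x ⟨hx, hxD⟩).trans (le_max_right _ _)
    · intro x hx
      obtain ⟨u, hu, p, hp⟩ := (contDiffWithinAt_nat (n := 2)).1 (hf x hx)
      rw [Set.insert_eq_of_mem hx] at hu
      have hxu : x ∈ u := mem_of_mem_nhdsWithin hx hu
      have hc : ContinuousWithinAt (fun y => p y 2) u x := hp.cont 2 (by norm_num) x hxu
      have hb : ∀ᶠ y in nhdsWithin x u, ‖p y 2‖ < ‖p x 2‖ + 1 :=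
        hc.norm.eventually_lt continuousWithinAt_const (by simp)
      have hb' : ∀ᶠ y in nhdsWithin x (closure D), y ∈ u → ‖p y 2‖ < ‖p x 2‖ + 1 :=
        nhdsWithin_le_nhds (eventually_nhdsWithin_iff.1 hb)
      obtain ⟨V, hV, hxV, hVu⟩ := mem_nhdsWithin.1 hu
      refine ⟨V ∩ {y | y ∈ u → ‖p y 2‖ < ‖p x 2‖ + 1},
        inter_mem (mem_nhdsWithin_of_mem_nhds (hV.mem_nhds hxV)) hb', ‖p x 2‖ + 1, ?_⟩
      rintro y ⟨⟨hyV, hy⟩, hyD⟩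
      have hsub : V ∩ D ⊆ u := fun z hz => hVu ⟨hz.1, subset_closure hz.2⟩
      have ho : IsOpen (V ∩ D) := hV.inter hD_open
      have e := (hp.mono hsub).eq_iteratedFDerivWithin_of_uniqueDiffOn (m := 2) le_rfl
        ho.uniqueDiffOn ⟨hyV, hyD⟩
      rw [iteratedFDerivWithin_of_isOpen 2 ho ⟨hyV, hyD⟩] at e
      rw [← e]
      exact (hy (hsub ⟨hyV, hyD⟩)).le
  obtain ⟨C, hC⟩ := this
  refine ⟨C, fun x hx i j => ?_⟩
  have h1 := (iteratedFDeriv ℝ 2 f x).le_opNorm ![Pi.single i 1, Pi.single j 1]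
  rw [iteratedFDeriv_two_apply] at h1
  simp only [Matrix.cons_val_zero, Matrix.cons_val_one, Fin.prod_univ_two, Pi.norm_single,
    norm_one, mul_one, ← lap_hess_apply (hcd x hx), Real.norm_eq_abs] at h1
  exact h1.trans (hC x ⟨subset_closure hx, hx⟩)

theorem lap_decay {d : ℕ} (D : Set (Fin d → ℝ)) (f : (Fin d → ℝ) → ℝ)
    (hD_bdd : Bornology.IsBounded D)
    (hf : ContinuousOn f (closure D))
    (x₀ : Fin d → ℝ) (hcd : ContDiffAt ℝ 2 f x₀) (h0 : fderiv ℝ f x₀ = 0)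
    (hmax : ∀ x ∈ closure D, x ≠ x₀ → f x < f x₀)
    (hHess : (-(Hess f x₀)).PosDef) :
    ∃ c > 0, ∀ x ∈ D, f x - f x₀ ≤ -c * ‖x - x₀‖ ^ 2 := by
  obtain ⟨c, hc, hq⟩ := lap_coercive _ hHess
  obtain ⟨δ, hδ, ht⟩ := lap_taylor hcd h0 (ε := c / 4) (by positivity)
  have near : ∀ x, ‖x - x₀‖ < δ → f x - f x₀ ≤ -(c / 4) * ‖x - x₀‖ ^ 2 := by
    intro x hx
    have h1 := (abs_le.1 (ht _ hx)).2
    have h2 := hq (x - x₀)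
    rw [lap_hess_quad hcd, add_sub_cancel] at h1
    linarith
  have hK : IsCompact (closure D \ Metric.ball x₀ δ) :=
    hD_bdd.isCompact_closure.diff Metric.isOpen_ball
  obtain ⟨R, hR⟩ := hD_bdd.subset_closedBall x₀
  rcases (closure D \ Metric.ball x₀ δ).eq_empty_or_nonempty with he | hne
  · refine ⟨c / 4, by positivity, fun x hx => near x ?_⟩
    by_contra hcon
    have : x ∈ closure D \ Metric.ball x₀ δ :=
      ⟨subset_closure hx, by simpa [dist_eq_norm] using hcon⟩
    rw [he] at this; exact this
  · obtain ⟨z, hz, hzm⟩ := hK.exists_isMaxOn hne (hf.mono Set.sdiff_subset)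
    have hzlt : f z < f x₀ := hmax z hz.1 (by rintro rfl; exact hz.2 (Metric.mem_ball_self hδ))
    refine ⟨min (c / 4) ((f x₀ - f z) / (|R| + 1) ^ 2),
      lt_min (by positivity) (div_pos (by linarith) (by positivity)), fun x hx => ?_⟩
    have hn : 0 ≤ ‖x - x₀‖ ^ 2 := by positivity
    by_cases hxδ : ‖x - x₀‖ < δ
    · refine (near x hxδ).trans ?_
      have := mul_le_mul_of_nonneg_right (min_le_left (c / 4) ((f x₀ - f z) / (|R| + 1) ^ 2)) hn
      linarith
    · have h1 : f x ≤ f z := hzm ⟨subset_closure hx, by simpa [dist_eq_norm] using hxδ⟩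
      have h2 : ‖x - x₀‖ ≤ |R| + 1 := by
        have := hR hx
        rw [Metric.mem_closedBall, dist_eq_norm] at this
        linarith [le_abs_self R]
      have h3 := mul_le_mul_of_nonneg_right (min_le_right (c / 4) ((f x₀ - f z) / (|R| + 1) ^ 2)) hn
      have h4 : (f x₀ - f z) / (|R| + 1) ^ 2 * ‖x - x₀‖ ^ 2 ≤ f x₀ - f z := by
        rw [div_mul_eq_mul_div, div_le_iff₀ (by positivity)]
        have : ‖x - x₀‖ ^ 2 ≤ (|R| + 1) ^ 2 := by gcongr
        exact mul_le_mul_of_nonneg_left this (by linarith)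
      linarith

theorem lap_integrable (d : ℕ) {c : ℝ} (hc : 0 < c) :
    Integrable (fun y : Fin d → ℝ => Real.exp (-c * ‖y‖ ^ 2)) := by
  have hc' : 0 < c / (d + 1) := by positivity
  have h1 : Integrable (fun y : Fin d → ℝ => ∏ i, Real.exp (-(c / (d + 1)) * y i ^ 2)) :=
    Integrable.fintype_prod (f := fun (_ : Fin d) (t : ℝ) => Real.exp (-(c / (d + 1)) * t ^ 2))
      (fun _ => integrable_exp_neg_mul_sq hc')
  refine h1.mono' (Continuous.aestronglyMeasurable (by fun_prop)) (ae_of_all _ fun y => ?_)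
  rw [Real.norm_eq_abs, abs_of_pos (Real.exp_pos _), ← Real.exp_sum, Real.exp_le_exp,
    ← Finset.mul_sum]
  have h2 : ∑ i, y i ^ 2 ≤ (d + 1) * ‖y‖ ^ 2 := by
    calc ∑ i, y i ^ 2 ≤ ∑ _i : Fin d, ‖y‖ ^ 2 := Finset.sum_le_sum fun i _ => by
          rw [← sq_abs (y i)]
          have := norm_le_pi_norm y i
          rw [Real.norm_eq_abs] at this
          gcongr
      _ = d * ‖y‖ ^ 2 := by simp
      _ ≤ _ := by nlinarith [sq_nonneg ‖y‖]
  have h3 := mul_le_mul_of_nonneg_left h2 hc'.le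
  have h4 : c / (d + 1) * ((d + 1) * ‖y‖ ^ 2) = c * ‖y‖ ^ 2 := by field_simp
  linarith

theorem laplace_asymptotic {d : ℕ} (D : Set (Fin d → ℝ)) (f : (Fin d → ℝ) → ℝ)
    (hD_open : IsOpen D) (hD_bdd : Bornology.IsBounded D)
    (hf : ContDiffOn ℝ 2 f (closure D))
    (x₀ : Fin d → ℝ) (hx₀ : x₀ ∈ D)
    (hmax : ∀ x ∈ closure D, x ≠ x₀ → f x < f x₀)
    (hHess : (-(Hess f x₀)).PosDef) :
    Tendsto
      (fun lam : ℝ =>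
        (∫ x in D, Real.sqrt |(Hess f x).det| * Real.exp (lam * f x)) /
          ((2 * π / lam) ^ ((d : ℝ) / 2) * Real.exp (lam * f x₀)))
      atTop (nhds 1) := by
  have hcd : ∀ x ∈ D, ContDiffAt ℝ 2 f x := fun x hx =>
    hf.contDiffAt (mem_of_superset (hD_open.mem_nhds hx) subset_closure)
  have hcd0 := hcd x₀ hx₀
  have h0 : fderiv ℝ f x₀ = 0 := by
    apply IsLocalMax.fderiv_eq_zero
    filter_upwards [hD_open.mem_nhds hx₀] with x hx
    by_cases h : x = x₀
    · rw [h]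
    · exact (hmax x (subset_closure hx) h).le
  obtain ⟨c, hc, hdec⟩ := lap_decay D f hD_bdd hf.continuousOn x₀ hcd0 h0 hmax hHess
  obtain ⟨C, hC⟩ := lap_hess_bound D f hD_open hD_bdd hf
  set g : (Fin d → ℝ) → ℝ := fun x => Real.sqrt |(Hess f x).det| with hg
  obtain ⟨M, hM⟩ : ∃ M : ℝ, ∀ x ∈ D, g x ≤ M := by
    refine ⟨Real.sqrt ((Fintype.card (Fin d)).factorial • C ^ Fintype.card (Fin d)), fun x hx => ?_⟩
    exact Real.sqrt_le_sqrt (Matrix.det_le (abv := AbsoluteValue.abs) (hC x hx))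
  have hgm : Measurable g := by
    have : ∀ i j, Measurable fun x => Hess f x i j := fun i j => by
      simp only [Hess, Matrix.of_apply]
      exact measurable_fderiv_apply_const ℝ _ _
    simp only [hg, Matrix.det_apply']
    fun_prop
  have hgc : ContinuousAt g x₀ := by
    have hH : ∀ i j, ContinuousAt (fun x => Hess f x i j) x₀ := fun i j => by
      have h2 : ContinuousAt (fderiv ℝ (fderiv ℝ f)) x₀ :=
        ((hcd0.fderiv_right (m := 1) (by norm_num)).fderiv_right (m := 0) (by norm_num)).continuousAt
      have h3 : ContinuousAt (fun x => fderiv ℝ (fderiv ℝ f) x (Pi.single i 1) (Pi.single j 1)) x₀ :=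
        (h2.clm_apply continuousAt_const).clm_apply continuousAt_const
      refine h3.congr ?_
      filter_upwards [hD_open.mem_nhds hx₀] with x hx
      rw [lap_hess_apply (hcd x hx)]
    simp only [hg, Matrix.det_apply']
    fun_prop
  set H : ℝ → (Fin d → ℝ) → ℝ := fun l => D.indicator (fun x => g x * Real.exp (l * (f x - f x₀)))
    with hHdef
  have hHm : ∀ l, Measurable (H l) := fun l => by
    have h1 : Measurable (D.indicator fun x => Real.exp (l * (f x - f x₀))) := by
      have hco : ContinuousOn (fun x => Real.exp (l * (f x - f x₀))) D := by
        have := hf.continuousOn.mono (subset_closure : D ⊆ closure D)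
        fun_prop
      classical
      rw [← Set.piecewise_eq_indicator]
      exact hco.measurable_piecewise continuousOn_const hD_open.measurableSet
    have : H l = fun x => g x * D.indicator (fun x => Real.exp (l * (f x - f x₀))) x := by
      ext x
      simp only [hHdef, Set.indicator]
      split_ifs <;> simp
    rw [this]
    exact hgm.mul h1
  set A := -(Hess f x₀) with hA
  have hlim : Tendsto (fun l : ℝ => ∫ y, H l (x₀ + (Real.sqrt l)⁻¹ • y)) atTop
      (nhds (∫ y : Fin d → ℝ, g x₀ * Real.exp (-(1 / 2) * (y ⬝ᵥ A.mulVec y)))) := by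
    refine tendsto_integral_filter_of_dominated_convergence
      (fun y => M * Real.exp (-c * ‖y‖ ^ 2)) ?_ ?_ ((lap_integrable d hc).const_mul M) ?_
    · refine Eventually.of_forall fun l => ?_
      exact ((hHm l).comp (by fun_prop)).aestronglyMeasurable
    · filter_upwards [eventually_gt_atTop 0] with l hl
      refine ae_of_all _ fun y => ?_
      have hM0 : 0 ≤ M := (Real.sqrt_nonneg _).trans (hM x₀ hx₀)
      by_cases hy : x₀ + (Real.sqrt l)⁻¹ • y ∈ D
      · simp only [hHdef, Set.indicator_of_mem hy]
        rw [Real.norm_eq_abs, abs_of_nonneg (mul_nonneg (Real.sqrt_nonneg _) (Real.exp_pos _).le)]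
        refine mul_le_mul (hM _ hy) (Real.exp_le_exp.2 ?_) (Real.exp_pos _).le hM0
        have h1 := mul_le_mul_of_nonneg_left (hdec _ hy) hl.le
        refine h1.trans (le_of_eq ?_)
        rw [add_sub_cancel_left, norm_smul, mul_pow, norm_inv, Real.norm_eq_abs, inv_pow, sq_abs,
          Real.sq_sqrt hl.le]
        field_simp
      · simp only [hHdef, Set.indicator_of_notMem hy, norm_zero]
        positivity
    · refine ae_of_all _ fun y => ?_
      have hs : Tendsto (fun l : ℝ => (Real.sqrt l)⁻¹) atTop (nhds 0) :=
        tendsto_inv_atTop_zero.comp Real.tendsto_sqrt_atTop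
      have hy0 : Tendsto (fun l : ℝ => (Real.sqrt l)⁻¹ • y) atTop (nhds 0) := by
        simpa using hs.smul_const y
      have hx : Tendsto (fun l : ℝ => x₀ + (Real.sqrt l)⁻¹ • y) atTop (nhds x₀) := by
        simpa using hy0.const_add x₀
      have hT : Tendsto (fun l : ℝ => l * (f (x₀ + (Real.sqrt l)⁻¹ • y) - f x₀)) atTop
          (nhds (-(1 / 2) * (y ⬝ᵥ A.mulVec y))) := by
        rw [Metric.tendsto_nhds]
        intro ε hε
        obtain ⟨δ, hδ, ht⟩ := lap_taylor hcd0 h0 (ε := ε / (2 * (‖y‖ ^ 2 + 1))) (by positivity)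
        have hev : ∀ᶠ l : ℝ in atTop, ‖(Real.sqrt l)⁻¹ • y‖ < δ := by
          have := hy0.norm
          rw [norm_zero] at this
          exact this.eventually_lt_const hδ
        filter_upwards [hev, eventually_gt_atTop 0] with l hl hl0
        have h1 := ht _ hl
        rw [lap_hess_quad hcd0, ← hA] at h1
        have hsq : (Real.sqrt l)⁻¹ ^ 2 * l = 1 := by
          rw [inv_pow, Real.sq_sqrt hl0.le, inv_mul_cancel₀ hl0.ne']
        simp only [Matrix.mulVec_smul, dotProduct_smul, smul_dotProduct, smul_eq_mul] at h1
        rw [norm_smul, mul_pow, Real.norm_eq_abs, sq_abs] at h1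
        have h2 := mul_le_mul_of_nonneg_left h1 hl0.le
        rw [← abs_of_pos hl0, ← abs_mul, abs_of_pos hl0] at h2
        rw [Real.dist_eq]
        set s := (Real.sqrt l)⁻¹
        calc _ = |l * (f (x₀ + s • y) - f x₀ - 1 / 2 * -(s * (s * (y ⬝ᵥ A.mulVec y))))| := by
              congr 1
              linear_combination (-(1 / 2) * (y ⬝ᵥ A.mulVec y)) * hsq
          _ ≤ _ := h2
          _ = ε / (2 * (‖y‖ ^ 2 + 1)) * ‖y‖ ^ 2 * (s ^ 2 * l) := by ring
          _ = ε * ‖y‖ ^ 2 / (2 * (‖y‖ ^ 2 + 1)) := by rw [hsq]; ring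
          _ < ε := by
              rw [div_lt_iff₀ (by positivity)]
              nlinarith [sq_nonneg ‖y‖, mul_nonneg hε.le (sq_nonneg ‖y‖)]
      have hfin := (hgc.tendsto.comp hx).mul ((Real.continuous_exp.tendsto _).comp hT)
      refine hfin.congr' ?_
      filter_upwards [hx.eventually (hD_open.mem_nhds hx₀)] with l hl
      simp only [hHdef, Set.indicator_of_mem hl, Function.comp_apply]
  rw [integral_const_mul, lap_gauss A hHess] at hlim
  have hgA : g x₀ = Real.sqrt A.det := by
    have : |(Hess f x₀).det| = A.det := by
      rw [← abs_of_pos hHess.det_pos, hA, Matrix.det_neg, abs_mul]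
      simp
    simp only [hg, this]
  have hdet : Real.sqrt A.det ≠ 0 := (Real.sqrt_pos.2 hHess.det_pos).ne'
  rw [hgA, mul_div_cancel₀ _ hdet] at hlim
  have hp : (0:ℝ) < (2 * π) ^ ((d : ℝ) / 2) := by positivity
  have hlim2 := hlim.div_const ((2 * π) ^ ((d : ℝ) / 2))
  rw [div_self hp.ne'] at hlim2
  refine hlim2.congr' ?_
  filter_upwards [eventually_gt_atTop 0] with l hl
  rw [Measure.integral_comp_inv_smul_of_nonneg volume (fun z => H l (x₀ + z)) (Real.sqrt_nonneg l),
    integral_add_left_eq_self (H l) x₀, integral_indicator hD_open.measurableSet]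
  have e1 : ∫ x in D, g x * Real.exp (l * (f x - f x₀))
      = (∫ x in D, g x * Real.exp (l * f x)) * Real.exp (-(l * f x₀)) := by
    rw [← integral_mul_const]
    congr 1; ext x
    rw [mul_assoc, ← Real.exp_add]; congr 2; ring
  have e2 : Real.sqrt l ^ d = l ^ ((d : ℝ) / 2) := by
    rw [Real.sqrt_eq_rpow, ← Real.rpow_mul_natCast hl.le]; congr 1; ring
  rw [e1, Module.finrank_fin_fun, e2, Real.div_rpow (by positivity) hl.le, Real.exp_neg, smul_eq_mul]
  have : 0 < l ^ ((d : ℝ) / 2) := by positivity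
  field_simp
  rfl
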